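/- arXiv:1812.11768 — 3 statements merged into one kernel-verified Lean document; each statement's English description precedes it below -/
import Mathlib

section
/- Chang's Conjecture is transitive: if κ₀ ≤ κ₁, μ₀ ≤ μ₁, and ν₀ ≤ ν₁ are infinite cardinals such that (κ₁,κ₀) ↠ (μ₁,μ₀) and (μ₁,μ₀) ↠ (ν₁,ν₀), then (κ₁,κ₀) ↠ (ν₁,ν₀). -/
open Cardinal Ordinal

/-- Chang's Conjecture `(κ₁,κ₀) ↠ (μ₁,μ₀)`: every structure in a countable first-order
language on the set of ordinals below the initial ordinal of `κ₁` has a substructure of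
cardinality `μ₁` whose intersection with the ordinals below the initial ordinal of `κ₀`
has cardinality `μ₀`. -/
def ChangCC (κ₁ κ₀ μ₁ μ₀ : Cardinal.{0}) : Prop :=
  ∀ (L : FirstOrder.Language.{0,0}) (_ : Countable L.Symbols) (_ : L.Structure (Set.Iio κ₁.ord)),
    ∃ B : L.Substructure (Set.Iio κ₁.ord),
      #B = Cardinal.lift.{1,0} μ₁ ∧
      #{x : Set.Iio κ₁.ord // x ∈ B ∧ x.val < κ₀.ord} = Cardinal.lift.{1,0} μ₀

open scoped FirstOrder

theorem chang_aux_eq (κ₁ κ₀ ν : Cardinal.{0}) (hν : ℵ₀ ≤ ν)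
    (L : FirstOrder.Language.{0,0}) (hL : Countable L.Symbols)
    (inst : L.Structure (Set.Iio κ₁.ord))
    (h : Cardinal.lift.{1,0} ν ≤ #{x : Set.Iio κ₁.ord | x.val < κ₀.ord}) :
    ∃ B : L.Substructure (Set.Iio κ₁.ord),
      #B = Cardinal.lift.{1,0} ν ∧
      #{x : Set.Iio κ₁.ord // x ∈ B ∧ x.val < κ₀.ord} = Cardinal.lift.{1,0} ν := by
  obtain ⟨t, hts, ht⟩ := Cardinal.le_mk_iff_exists_subset.1 h
  have hν' : ℵ₀ ≤ Cardinal.lift.{1,0} ν := by simpa using hν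
  let D := FirstOrder.Language.Substructure.closure L t
  have hF : Countable (Σ n, L.Functions n) :=
    Function.Injective.countable (f := (Sum.inl : _ → L.Symbols)) Sum.inl_injective
  have hD : #D ≤ Cardinal.lift.{1,0} ν := by
    have := FirstOrder.Language.Substructure.lift_card_closure_le (L := L) (s := t)
    rw [Cardinal.lift_id'.{0,1}] at this
    refine this.trans (max_le hν' ?_)
    refine Cardinal.add_le_of_le hν' ?_ ?_
    · rw [ht]; simp
    · refine le_trans ?_ hν'
      exact Cardinal.lift_le_aleph0.2 (Cardinal.mk_le_aleph0_iff.2 hF)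
  have h1 : Cardinal.lift.{1,0} ν ≤ #{x : Set.Iio κ₁.ord // x ∈ D ∧ x.val < κ₀.ord} := by
    rw [← ht]
    exact Cardinal.mk_le_mk_of_subset (t := {x | x ∈ D ∧ x.val < κ₀.ord})
      fun x hx => ⟨FirstOrder.Language.Substructure.subset_closure hx, hts hx⟩
  have h2 : #{x : Set.Iio κ₁.ord // x ∈ D ∧ x.val < κ₀.ord} ≤ #D :=
    Cardinal.mk_le_mk_of_subset (s := {x | x ∈ D ∧ x.val < κ₀.ord}) (t := (D : Set _))
      fun x hx => hx.1
  exact ⟨D, le_antisymm hD (h1.trans h2), le_antisymm (h2.trans hD) h1⟩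

theorem chang_aux_equiv {α β : Type 1} [Infinite α] [Infinite β] (p : α → Prop) (q : β → Prop)
    (h : #α = #β) (hpq : #{x // p x} = #{x // q x}) (hlt : #{x // p x} < #α) :
    ∃ e : α ≃ β, ∀ x, p x ↔ q (e x) := by
  classical
  have hp : #{x // ¬ p x} = #α := Cardinal.mk_compl_of_infinite {x | p x} hlt
  have hq : #{x // ¬ q x} = #β := Cardinal.mk_compl_of_infinite {x | q x} (by
    rw [← h]; exact hpq ▸ hlt)
  obtain ⟨e1⟩ := Cardinal.eq.1 hpq
  obtain ⟨e2⟩ := Cardinal.eq.1 (hp.trans (h.trans hq.symm))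
  refine ⟨(Equiv.sumCompl p).symm.trans ((Equiv.sumCongr e1 e2).trans (Equiv.sumCompl q)), ?_⟩
  intro x
  by_cases hx : p x
  · simp [hx, Equiv.sumCompl_symm_apply_of_pos, (e1 ⟨x, hx⟩).2]
  · simp [hx, Equiv.sumCompl_symm_apply_of_neg, (e2 ⟨x, hx⟩).2]

theorem chang_trans (κ₁ κ₀ μ₁ μ₀ ν₁ ν₀ : Cardinal.{0})
    (hκ₀ : ℵ₀ ≤ κ₀) (hμ₀ : ℵ₀ ≤ μ₀) (hν₀ : ℵ₀ ≤ ν₀)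
    (hκ : κ₀ ≤ κ₁) (hμ : μ₀ ≤ μ₁) (hν : ν₀ ≤ ν₁)
    (h₁ : ChangCC κ₁ κ₀ μ₁ μ₀) (h₂ : ChangCC μ₁ μ₀ ν₁ ν₀) :
    ChangCC κ₁ κ₀ ν₁ ν₀ := by
  intro L hL inst
  obtain ⟨B, hB, hB0⟩ := h₁ L hL inst
  have hIio : #(Set.Iio μ₁.ord) = Cardinal.lift.{1,0} μ₁ := by
    rw [Cardinal.mk_Iio_ordinal, Cardinal.card_ord]
  have hμ₁ : ℵ₀ ≤ μ₁ := hμ₀.trans hμ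
  rcases hμ.eq_or_lt with rfl | hlt
  · obtain ⟨C, hC, hC0⟩ := h₂ FirstOrder.Language.empty (by infer_instance)
      FirstOrder.Language.emptyStructure
    have e : #{x : Set.Iio μ₀.ord // x ∈ C ∧ x.val < μ₀.ord} = #C :=
      Cardinal.mk_congr (Equiv.subtypeEquivRight fun x => ⟨fun h => h.1, fun h => ⟨h, x.2⟩⟩)
    have hνν : ν₁ = ν₀ := by
      rw [e, hC] at hC0
      exact Cardinal.lift_injective hC0
    subst hνν
    have hνμ : Cardinal.lift.{1,0} ν₁ ≤ Cardinal.lift.{1,0} μ₀ := by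
      rw [← hC, ← hIio]
      exact Cardinal.mk_subtype_le _
    refine chang_aux_eq κ₁ κ₀ ν₁ hν₀ L hL inst (hνμ.trans ?_)
    rw [← hB0]
    exact Cardinal.mk_le_mk_of_subset (s := {x | x ∈ B ∧ x.val < κ₀.ord})
      fun x hx => hx.2
  · have i1 : Infinite B := by
      rw [Cardinal.infinite_iff, hB]; simpa using hμ₁
    have i2 : Infinite (Set.Iio μ₁.ord) := by
      rw [Cardinal.infinite_iff, hIio]; simpa using hμ₁
    have c1 : #{x : B // x.val.val < κ₀.ord} = Cardinal.lift.{1,0} μ₀ := by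
      rw [← hB0]
      exact Cardinal.mk_congr (Equiv.subtypeSubtypeEquivSubtypeInter (fun x => x ∈ B)
        (fun x : Set.Iio κ₁.ord => x.val < κ₀.ord))
    have c2 : #{x : Set.Iio μ₁.ord // x.val < μ₀.ord} = Cardinal.lift.{1,0} μ₀ := by
      have : #(Set.Iio μ₀.ord) = Cardinal.lift.{1,0} μ₀ := by
        rw [Cardinal.mk_Iio_ordinal, Cardinal.card_ord]
      rw [← this]
      exact Cardinal.mk_congr (Equiv.subtypeSubtypeEquivSubtype
        (fun {x} (hx : x < μ₀.ord) => lt_of_lt_of_le hx (Cardinal.ord_le_ord.2 hμ)))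
    obtain ⟨e, he⟩ := chang_aux_equiv (fun x : B => x.val.val < κ₀.ord)
      (fun x : Set.Iio μ₁.ord => x.val < μ₀.ord) (hB.trans hIio.symm) (c1.trans c2.symm)
      (by rw [c1, hB]; simpa using hlt)
    obtain ⟨C, hC, hC0⟩ := h₂ L hL e.inducedStructure
    let _ := e.inducedStructure (L := L)
    let f : (B ≃[L] (Set.Iio μ₁.ord)) := e.inducedStructureEquiv
    have hf : ∀ x, f x = e x := fun x => rfl
    let g : (Set.Iio μ₁.ord) ↪[L] (Set.Iio κ₁.ord) := B.subtype.comp f.symm.toEmbedding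
    have hg : ∀ x, (g x).val < κ₀.ord ↔ x.val < μ₀.ord := by
      intro x
      have := he (e.symm x)
      rw [e.apply_symm_apply] at this
      exact this
    refine ⟨C.map g.toHom, ?_, ?_⟩
    · rw [← hC]
      exact Cardinal.mk_image_eq (s := (C : Set _)) g.injective
    · rw [← hC0]
      have := Cardinal.mk_image_eq (s := {x | x ∈ C ∧ x.val < μ₀.ord}) g.injective
      refine Eq.trans ?_ this
      refine Cardinal.mk_congr (Equiv.subtypeEquivRight fun y => ?_)
      constructor
      · rintro ⟨⟨x, hx, rfl⟩, h⟩
        exact ⟨x, ⟨hx, (hg x).1 h⟩, rfl⟩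
      · rintro ⟨x, ⟨hx, h⟩, rfl⟩
        exact ⟨⟨x, hx, rfl⟩, (hg x).2 h⟩
end

section
/- Let κ be a singular cardinal and let ⟨f_α : α < κ⁺⟩ be a scale for κ. If α < κ⁺ satisfies cf(α) > cf(κ) and the scale is better at α, then the scale is good at α. -/
open Cardinal Ordinal

/-- `f < g` in the ordering modulo sets of size `< cf(κ)`:
`|{i < cf(κ) : f(i) ≥ g(i)}| < cf(κ)`.  (Indices range over ordinals below the initial
ordinal of `cf(κ) = κ.ord.cof`.) -/
def ptLT (κ : Cardinal.{0}) (f g : Ordinal → Ordinal) : Prop :=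
  #{i : Ordinal | i < κ.ord.cof.ord ∧ g i ≤ f i} < Cardinal.lift.{1,0} κ.ord.cof

/-- `h` is a member of the product `∏_{i < cf(κ)} κs i`. -/
def ProdMem (κ : Cardinal.{0}) (κs : Ordinal.{0} → Cardinal.{0}) (h : Ordinal → Ordinal) : Prop :=
  ∀ i < κ.ord.cof.ord, h i < (κs i).ord

/-- `(κs, f)` is a scale for the singular cardinal `κ`: `⟨κs i : i < cf(κ)⟩` is an increasing
sequence of regular cardinals cofinal in `κ`, and `⟨f α : α < κ⁺⟩` is increasing and cofinal
in `∏_{i<cf(κ)} κs i` with respect to `ptLT`. -/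
def IsScale (κ : Cardinal.{0}) (κs : Ordinal.{0} → Cardinal.{0})
    (f : Ordinal → Ordinal → Ordinal) : Prop :=
  (∀ i, i < κ.ord.cof.ord → (κs i).IsRegular ∧ κs i < κ) ∧
  (∀ i j, i < j → j < κ.ord.cof.ord → κs i < κs j) ∧
  (∀ c < κ, ∃ i < κ.ord.cof.ord, c < κs i) ∧
  (∀ α < (Order.succ κ).ord, ProdMem κ κs (f α)) ∧
  (∀ α β, α < β → β < (Order.succ κ).ord → ptLT κ (f α) (f β)) ∧
  (∀ h, ProdMem κ κs h → ∃ α < (Order.succ κ).ord, ptLT κ h (f α))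

/-- The scale `(κs, f)` is good at `α`: there are `⟨g ζ : ζ < cf(α)⟩` in the product and
`j* < cf(κ)` such that `⟨g ζ j : ζ < cf(α)⟩` is strictly increasing for all `j* ≤ j < cf(κ)`,
and `⟨g ζ⟩` and `⟨f β : β < α⟩` are mutually cofinal. -/
def GoodAt (κ : Cardinal.{0}) (κs : Ordinal.{0} → Cardinal.{0})
    (f : Ordinal → Ordinal → Ordinal) (α : Ordinal) : Prop :=
  ∃ (g : Ordinal → Ordinal → Ordinal) (j' : Ordinal), j' < κ.ord.cof.ord ∧
    (∀ ζ < α.cof.ord, ProdMem κ κs (g ζ)) ∧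
    (∀ j, j' ≤ j → j < κ.ord.cof.ord → ∀ ζ ζ', ζ < ζ' → ζ' < α.cof.ord → g ζ j < g ζ' j) ∧
    (∀ ζ < α.cof.ord, ∃ β < α, ptLT κ (g ζ) (f β)) ∧
    (∀ β < α, ∃ ζ < α.cof.ord, ptLT κ (f β) (g ζ))

/-- `C` is a club (closed unbounded) subset of `α`: `C ⊆ α`, `C` contains each of its limit
points below `α`, and `C` is unbounded in `α`. -/
def IsClubIn (C : Set Ordinal.{0}) (α : Ordinal.{0}) : Prop :=
  C ⊆ Set.Iio α ∧
  (∀ β < α, 0 < β → sSup (C ∩ Set.Iio β) = β → β ∈ C) ∧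
  (∀ γ < α, ∃ δ ∈ C, γ ≤ δ)

/-- The scale `f` is better at `α`: there is a club `C ⊆ α` such that for every `β ∈ C` there
is `j < cf(κ)` with `f γ i < f β i` for all `j ≤ i < cf(κ)` and all `γ ∈ C ∩ β`. -/
def BetterAt (κ : Cardinal.{0}) (f : Ordinal → Ordinal → Ordinal) (α : Ordinal) : Prop :=
  ∃ C : Set Ordinal, IsClubIn C α ∧
    ∀ β ∈ C, ∃ j < κ.ord.cof.ord,
      ∀ i, j ≤ i → i < κ.ord.cof.ord → ∀ γ ∈ C, γ < β → f γ i < f β i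

theorem exists_enum_aux {o : Ordinal.{0}} {S : Set (Set.Iio o)} (hS : IsCofinal S) :
    ∃ b : Set.Iio o.cof.ord → Set.Iio o, StrictMono b ∧ (∀ i, b i ∈ S) ∧
      IsCofinal (Set.range b) := by
  obtain ⟨t, htS, ht, ht'⟩ := exists_ord_cof_eq_of_isCofinal
    (s := (ToType.mk (o := o)) '' S) (by rwa [OrderIso.map_isCofinal_iff])
  rw [cof_toType] at ht'
  let g := (OrderIso.setCongr _ _ (congrArg Set.Iio ht'.symm)).trans <|
    .ofRelIsoLT (enum (α := t) (· < ·))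
  refine ⟨fun i => (ToType.mk (o := o)).symm (g i).1, fun _ ↦ by simp, fun i => ?_, ?_⟩
  · obtain ⟨x, hx, hx'⟩ := htS (g i).2
    beta_reduce
    rw [← hx']
    simpa using hx
  · rw [Set.range_comp', OrderIso.map_isCofinal_iff, Set.range_comp', g.range_eq]
    simpa

theorem better_implies_good (κ : Cardinal.{0})
    (hκ : ℵ₀ ≤ κ) (hsing : κ.ord.cof < κ)
    (κs : Ordinal.{0} → Cardinal.{0}) (f : Ordinal → Ordinal → Ordinal)
    (hscale : IsScale κ κs f)
    (α : Ordinal) (hα : α < (Order.succ κ).ord) (hcof : κ.ord.cof < α.cof)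
    (hbetter : BetterAt κ f α) :
    GoodAt κ κs f α := by
  obtain ⟨C, ⟨hC1, -, hC3⟩, hC⟩ := hbetter
  obtain ⟨-, -, -, hmem, hinc, -⟩ := hscale
  have h1 : 1 < κ.ord.cof :=
    Ordinal.one_lt_cof_iff.2 (Cardinal.isSuccLimit_ord hκ)
  have hlim : Order.IsSuccLimit α := Ordinal.one_lt_cof_iff.1 (h1.trans hcof)
  have key : ∃ j < κ.ord.cof.ord, ∀ γ < α, ∃ β ∈ C, γ ≤ β ∧
      ∀ i, j ≤ i → i < κ.ord.cof.ord → ∀ γ ∈ C, γ < β → f γ i < f β i := by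
    by_contra! hcon
    choose! γ hγ hγ' using hcon
    have hs : (⨆ j : Set.Iio κ.ord.cof.ord, γ j.1) < α := by
      apply lift_iSup_lt_of_lt_cof
      · rw [Cardinal.mk_Iio_ordinal, ← lift_cof]
        rw [Cardinal.card_ord, Cardinal.lift_uzero]
        exact Cardinal.lift_lt.2 hcof
      · exact fun j => hγ j.1 j.2
    obtain ⟨β, hβ, hle⟩ := hC3 _ hs
    obtain ⟨j, hj, hj'⟩ := hC β hβ
    have h2 : γ j ≤ β := (Ordinal.le_iSup (fun j : Set.Iio κ.ord.cof.ord => γ j.1) ⟨j, hj⟩).trans hle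
    obtain ⟨i, hi1, hi2, δ, hδ, hδβ, hle⟩ := hγ' j hj β hβ h2
    exact absurd (hj' i hi1 hi2 δ hδ hδβ) hle.not_gt
  obtain ⟨j, hj, hjC⟩ := key
  obtain ⟨b, hb, hbS, hbc⟩ := exists_enum_aux (o := α) (S := {β | β.1 ∈ C ∧
      ∀ i, j ≤ i → i < κ.ord.cof.ord → ∀ γ ∈ C, γ < β.1 → f γ i < f β.1 i}) (by
    intro x
    obtain ⟨β, hβ, hle, h⟩ := hjC x.1 x.2
    exact ⟨⟨β, hC1 hβ⟩, ⟨hβ, h⟩, hle⟩)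
  refine ⟨fun ζ => if h : ζ < α.cof.ord then f (b ⟨ζ, h⟩).1 else f 0, j, hj, ?_, ?_, ?_, ?_⟩
  · intro ζ hζ
    simp only [hζ, dif_pos]
    exact hmem _ ((b ⟨ζ, hζ⟩).2.trans hα)
  · intro i hi1 hi2 ζ ζ' hlt hζ'
    have hζ := hlt.trans hζ'
    simp only [hζ, hζ', dif_pos]
    exact (hbS ⟨ζ', hζ'⟩).2 i hi1 hi2 _ (hbS ⟨ζ, hζ⟩).1 (hb (show (⟨ζ, hζ⟩ : Set.Iio _) < ⟨ζ', hζ'⟩ from hlt))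
  · intro ζ hζ
    simp only [hζ, dif_pos]
    have h2 := hlim.succ_lt (b ⟨ζ, hζ⟩).2
    exact ⟨_, h2, hinc _ _ (Order.lt_succ _) (h2.trans hα)⟩
  · intro β hβ
    obtain ⟨_, ⟨⟨ζ, hζ⟩, rfl⟩, hle⟩ := hbc ⟨Order.succ β, hlim.succ_lt hβ⟩
    have hζ' : ζ < α.cof.ord := hζ
    refine ⟨ζ, hζ', ?_⟩
    simp only [hζ', dif_pos]
    exact hinc _ _ ((Order.lt_succ β).trans_le hle) ((b ⟨ζ, hζ⟩).2.trans hα)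
end

section
/- Let μ be a singular cardinal. Suppose there is a sequence ⟨ℰ_α : α < μ⁺⟩ such that: each ℰ_α is a collection of at most μ many club subsets of α, each of size < μ; ℰ_α is nonempty whenever cf(α) > cf(μ); and whenever C ∈ ℰ_α and β is a limit point of C, then C ∩ β ∈ ℰ_β. Suppose also that there exists a scale for μ. Then there exists a better scale for μ. -/
open Cardinal Ordinal

theorem bs_bdd {S : Set Ordinal.{0}} {a : Ordinal.{0}}
    (hS : #S < Cardinal.lift.{1,0} a.cof) (h : ∀ x ∈ S, x < a) :
    BddAbove S ∧ sSup S < a :=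
  ⟨⟨a, fun x hx => (h x hx).le⟩,
    Ordinal.sSup_lt_of_lt_cof (by rwa [← Ordinal.lift_cof]) h⟩

theorem bs_rec (Q : Ordinal.{0} → (Ordinal.{0} → Ordinal.{0}) → Ordinal.{0} → Prop)
    (hc : ∀ α e e', (∀ β < α, e β = e' β) → ∀ x, Q α e x → Q α e' x)
    (hs : ∀ α e, (∀ β < α, Q β e (e β)) → ∃ x, Q α e x) :
    ∃ e : Ordinal.{0} → Ordinal.{0}, ∀ α, Q α e (e α) := by
  classical
  let F : (α : Ordinal.{0}) → ((β : Ordinal.{0}) → β < α → Ordinal.{0}) → Ordinal.{0} :=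
    fun α r =>
      if h : ∃ x, Q α (fun β => if hb : β < α then r β hb else 0) x then h.choose else 0
  let e : Ordinal.{0} → Ordinal.{0} := WellFounded.fix (r := (· < ·)) Ordinal.lt_wf F
  have he : ∀ α, e α = F α (fun β _ => e β) := fun α => WellFounded.fix_eq _ _ _
  refine ⟨e, fun α => ?_⟩
  induction α using Ordinal.induction with
  | h α ih =>
    obtain ⟨x, hx⟩ := hs α e ih
    have hex : ∃ x, Q α (fun β => if hb : β < α then e β else 0) x :=
      ⟨x, hc _ _ _ (fun β hb => by simp [hb]) _ hx⟩
    have h1 : e α = hex.choose := by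
      rw [he]
      exact dif_pos hex
    rw [h1]
    exact hc _ _ _ (fun β hb => by simp [hb]) _ hex.choose_spec

theorem bs_bound {c : Cardinal.{0}} (hc : c.IsRegular) {S : Set Ordinal.{0}}
    (hS : #S < Cardinal.lift.{1,0} c) (h : ∀ x ∈ S, x < c.ord) :
    ∃ y < c.ord, ∀ x ∈ S, x < y := by
  obtain ⟨h1, h2⟩ := bs_bdd (a := c.ord) (by rwa [hc.cof_ord]) h
  refine ⟨Order.succ (sSup S), (Cardinal.isSuccLimit_ord hc.aleph0_le).succ_lt h2, fun x hx => ?_⟩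
  exact Order.lt_succ_of_le (le_csSup h1 hx)

theorem bs_iff {μ : Cardinal.{0}} (hr : μ.ord.cof.IsRegular) (f g : Ordinal.{0} → Ordinal.{0}) :
    ptLT μ f g ↔ ∃ j < μ.ord.cof.ord, ∀ i, j ≤ i → i < μ.ord.cof.ord → f i < g i := by
  constructor
  · intro h
    obtain ⟨y, hy, h'⟩ := bs_bound hr h (fun x hx => hx.1)
    refine ⟨y, hy, fun i hi hi' => ?_⟩
    by_contra hcon
    exact absurd (h' i ⟨hi', not_lt.1 hcon⟩) (not_lt.2 hi)
  · rintro ⟨j, hj, h⟩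
    have hsub : {i : Ordinal | i < μ.ord.cof.ord ∧ g i ≤ f i} ⊆ Set.Iio j := by
      rintro i ⟨hi, hi'⟩
      by_contra hcon
      exact absurd (h i (not_lt.1 hcon) hi) (not_lt.2 hi')
    refine (Cardinal.mk_le_mk_of_subset hsub).trans_lt ?_
    rw [Cardinal.mk_Iio_ordinal, Cardinal.lift_lt]
    exact Cardinal.lt_ord.1 hj

theorem bs_trans {μ : Cardinal.{0}} (hr : μ.ord.cof.IsRegular) {f g h : Ordinal.{0} → Ordinal.{0}}
    (h1 : ptLT μ f g) (h2 : ptLT μ g h) : ptLT μ f h := by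
  rw [bs_iff hr] at *
  obtain ⟨j, hj, a⟩ := h1
  obtain ⟨k, hk, b⟩ := h2
  exact ⟨max j k, max_lt hj hk, fun i hi hi' =>
    (a i ((le_max_left _ _).trans hi) hi').trans (b i ((le_max_right _ _).trans hi) hi')⟩

/-- limit points of a club in an ordinal of uncountable cofinality form a club -/
theorem bs_lim {α : Ordinal.{0}} (hα : ℵ₀ < α.cof) {C : Set Ordinal.{0}} (hC : IsClubIn C α) :
    IsClubIn {β | β < α ∧ 0 < β ∧ sSup (C ∩ Set.Iio β) = β} α := by
  obtain ⟨hsub, hcl, hub⟩ := hC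
  have hlim : Order.IsSuccLimit α := Ordinal.aleph0_le_cof.1 hα.le
  refine ⟨fun β h => h.1, ?_, ?_⟩
  · intro β hβ h0 hs
    refine ⟨hβ, h0, le_antisymm ?_ ?_⟩
    · exact csSup_le' fun x hx => hx.2.le
    · conv_lhs => rw [← hs]
      refine csSup_le_csSup' ⟨β, fun x hx => hx.2.le⟩ ?_
      rintro x ⟨⟨a, b, c⟩, d⟩
      exact ⟨hcl x a b c, d⟩
  · intro γ hγ
    have step : ∀ x : Set.Iio α, ∃ y : Set.Iio α, y.1 ∈ C ∧ x.1 < y.1 := by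
      rintro ⟨x, hx⟩
      obtain ⟨δ, hδ, h⟩ := hub (Order.succ x) (hlim.succ_lt hx)
      exact ⟨⟨δ, hsub hδ⟩, hδ, Order.succ_le_iff.1 h⟩
    choose s hsC hsl using step
    let c : ℕ → Set.Iio α := fun n => s^[n] ⟨γ, hγ⟩
    have hc : ∀ n, c (n+1) = s (c n) := fun n => Function.iterate_succ_apply' _ _ _
    have hcC : ∀ n, (c (n+1)).1 ∈ C := fun n => by rw [hc]; exact hsC _
    have hcl' : ∀ n, (c n).1 < (c (n+1)).1 := fun n => by rw [hc]; exact hsl _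
    have hle : ∀ n, (c n).1 ≤ ⨆ n, (c n).1 := fun n => Ordinal.le_iSup (fun n => (c n).1) n
    have hlt : ∀ n, (c n).1 < ⨆ n, (c n).1 := fun n => (hcl' n).trans_le (hle _)
    refine ⟨⨆ n, (c n).1, ⟨?_, ?_, le_antisymm ?_ ?_⟩, (hlt 0).le⟩
    · exact Ordinal.iSup_lt_of_lt_cof (by simpa using hα) fun n => (c n).2
    · exact zero_le.trans_lt (hlt 0)
    · exact csSup_le' fun x hx => hx.2.le
    · refine Ordinal.iSup_le fun n => (hcl' n).le.trans ?_
      exact le_csSup ⟨_, fun x hx => (Set.mem_Iio.1 hx.2).le⟩ ⟨hcC n, hlt (n+1)⟩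

open Classical in
/-- pointwise strict supremum of `f (e γ)`, `γ ∈ C`, below `α`, at coordinates exceeding `|C|`. -/
noncomputable def bsH (μs : Ordinal.{0} → Cardinal.{0}) (f : Ordinal.{0} → Ordinal.{0} → Ordinal.{0})
    (α : Ordinal.{0}) (e : Ordinal.{0} → Ordinal.{0}) (C : Set Ordinal.{0}) (i : Ordinal.{0}) :
    Ordinal.{0} :=
  if #C < Cardinal.lift.{1,0} (μs i) then sSup ((fun γ => f (e γ) i) '' (C ∩ Set.Iio α)) else 0

theorem better_scale_of_partial_square (μ : Cardinal.{0})
    (hμ : ℵ₀ ≤ μ) (hsing : μ.ord.cof < μ)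
    (ℰ : Ordinal → Set (Set Ordinal))
    (hcard : ∀ α < (Order.succ μ).ord, #(ℰ α) ≤ Cardinal.lift.{1,0} μ)
    (hclub : ∀ α < (Order.succ μ).ord, ∀ C ∈ ℰ α,
      IsClubIn C α ∧ #C < Cardinal.lift.{1,0} μ)
    (hne : ∀ α < (Order.succ μ).ord, μ.ord.cof < α.cof → (ℰ α).Nonempty)
    (hcoh : ∀ α < (Order.succ μ).ord, ∀ C ∈ ℰ α, ∀ β < α,
      0 < β → sSup (C ∩ Set.Iio β) = β → C ∩ Set.Iio β ∈ ℰ β)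
    (hex : ∃ μs f, IsScale μ μs f) :
    ∃ μs f, IsScale μ μs f ∧
      ∀ α < (Order.succ μ).ord, μ.ord.cof < α.cof → BetterAt μ f α := by

  obtain ⟨μs, f, hreg, hinc, hcof, hmem, hlt, hdom⟩ := hex
  have hr : μ.ord.cof.IsRegular := Cardinal.isRegular_cof (Cardinal.isSuccLimit_ord hμ)
  have hsr : (Order.succ μ).IsRegular := Cardinal.isRegular_succ hμ
  have key : ∃ e : Ordinal.{0} → Ordinal.{0}, ∀ α, α < (Order.succ μ).ord →
      (e α < (Order.succ μ).ord ∧ α ≤ e α ∧ (∀ β < α, e β < e α) ∧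
        ∀ C ∈ ℰ α, ptLT μ (bsH μs f α e C) (f (e α))) := by
    refine bs_rec (fun α e x => α < (Order.succ μ).ord →
      (x < (Order.succ μ).ord ∧ α ≤ x ∧ (∀ β < α, e β < x) ∧
        ∀ C ∈ ℰ α, ptLT μ (bsH μs f α e C) (f x))) ?_ ?_
    · intro α e e' h x hQ hα
      obtain ⟨a, b, c, d⟩ := hQ hα
      refine ⟨a, b, fun β hβ => h β hβ ▸ c β hβ, fun C hC => ?_⟩
      have : bsH μs f α e' C = bsH μs f α e C := by
        funext i
        have : (fun γ => f (e' γ) i) '' (C ∩ Set.Iio α) = (fun γ => f (e γ) i) '' (C ∩ Set.Iio α) :=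
          Set.image_congr fun γ hγ => by rw [h γ hγ.2]
        simp only [bsH, this]
      rw [this]
      exact d C hC
    · intro α e ih
      by_cases hα : α < (Order.succ μ).ord
      swap
      · exact ⟨0, fun h => absurd h hα⟩
      have hH : ∀ C ∈ ℰ α, ∃ a < (Order.succ μ).ord, ptLT μ (bsH μs f α e C) (f a) := by
        intro C hC
        apply hdom
        intro i hi
        unfold bsH
        split_ifs with h
        · refine (bs_bdd ?_ ?_).2
          · rw [(hreg i hi).1.cof_ord]
            exact (Cardinal.mk_image_le.trans (Cardinal.mk_le_mk_of_subset Set.inter_subset_left)).trans_lt h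
          · rintro _ ⟨γ, hγ, rfl⟩
            exact hmem _ (ih γ hγ.2 (lt_trans hγ.2 hα)).1 i hi
        · exact (Cardinal.isSuccLimit_ord (hreg i hi).1.aleph0_le).bot_lt
      choose! a ha ha' using hH
      have hμl : Cardinal.lift.{1,0} μ < Cardinal.lift.{1,0} (Order.succ μ) :=
        Cardinal.lift_lt.2 (Order.lt_succ μ)
      obtain ⟨y₁, hy₁, h₁⟩ := bs_bound hsr (S := a '' ℰ α)
        ((Cardinal.mk_image_le.trans (hcard α hα)).trans_lt hμl)
        (by rintro _ ⟨C, hC, rfl⟩; exact ha C hC)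
      obtain ⟨y₂, hy₂, h₂⟩ := bs_bound hsr (S := e '' Set.Iio α)
        (Cardinal.mk_image_le.trans_lt (by
          rw [Cardinal.mk_Iio_ordinal, Cardinal.lift_lt]
          exact Cardinal.lt_ord.1 hα))
        (by rintro _ ⟨β, hβ, rfl⟩; exact (ih β hβ (lt_trans hβ hα)).1)
      refine ⟨max α (max y₁ y₂), fun _ => ⟨max_lt hα (max_lt hy₁ hy₂), le_max_left _ _, ?_, ?_⟩⟩
      · intro β hβ
        exact (h₂ _ ⟨β, hβ, rfl⟩).trans_le ((le_max_right _ _).trans (le_max_right _ _))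
      · intro C hC
        refine bs_trans hr (ha' C hC) (hlt _ _ ?_ (max_lt hα (max_lt hy₁ hy₂)))
        exact (h₁ _ ⟨C, hC, rfl⟩).trans_le ((le_max_left _ _).trans (le_max_right _ _))
  obtain ⟨e, he⟩ := key
  refine ⟨μs, fun α => f (e α), ⟨hreg, hinc, hcof, fun α hα => hmem _ (he α hα).1, ?_, ?_⟩, ?_⟩
  · intro α β hαβ hβ
    exact hlt _ _ ((he β hβ).2.2.1 α hαβ) (he β hβ).1
  · intro h hh
    obtain ⟨α, hα, hl⟩ := hdom h hh
    refine ⟨α, hα, ?_⟩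
    rcases (he α hα).2.1.eq_or_lt with h' | h'
    · show ptLT μ h (f (e α))
      rwa [← h']
    · exact bs_trans hr hl (hlt _ _ h' (he α hα).1)
  · intro α hα hcf
    obtain ⟨C, hC⟩ := hne α hα hcf
    obtain ⟨hCc, hCs⟩ := hclub α hα C hC
    refine ⟨_, bs_lim (hr.aleph0_le.trans_lt hcf) hCc, ?_⟩
    rintro β ⟨hβ, h0, hs⟩
    have hβ' := hβ.trans hα
    have hD := hcoh α hα C hC β hβ h0 hs
    obtain ⟨j, hj, hj'⟩ := (bs_iff hr _ _).1 ((he β hβ').2.2.2 _ hD)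
    obtain ⟨c, hc⟩ : ∃ c, Cardinal.lift.{1,0} c = #C := 
      (Cardinal.mem_range_lift_of_le hCs.le)
    obtain ⟨k, hk, hk'⟩ := hcof c (by rw [← hc] at hCs; exact Cardinal.lift_lt.1 hCs)
    refine ⟨max j k, max_lt hj hk, fun i hi hi' γ hγ hγβ => ?_⟩
    have h1 := hj' i ((le_max_left _ _).trans hi) hi'
    have hck : c < μs i := by
      rcases ((le_max_right _ _).trans hi).eq_or_lt with h | h
      · rwa [← h]
      · exact hk'.trans (hinc _ _ h hi')
    have hsz : #(C ∩ Set.Iio β : Set Ordinal) < Cardinal.lift.{1,0} (μs i) := by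
      refine (Cardinal.mk_le_mk_of_subset Set.inter_subset_left).trans_lt ?_
      rw [← hc]
      exact Cardinal.lift_lt.2 hck
    rw [bsH, if_pos hsz] at h1
    refine lt_of_le_of_lt ?_ h1
    have hγC : γ ∈ C := hCc.2.1 γ hγ.1 hγ.2.1 hγ.2.2
    refine le_csSup ⟨(μs i).ord, ?_⟩ ⟨γ, ⟨⟨hγC, hγβ⟩, hγβ⟩, rfl⟩
    rintro _ ⟨δ, hδ, rfl⟩
    exact (hmem _ (he δ (lt_trans hδ.2 hβ')).1 i hi').le
end
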